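/- For every local model on the two-source network in which source S₁ connects parties A¹, A², A³ and source S₂ connects parties A³, A⁴: if ⟨(a¹_0 a²_1 + a¹_1 a²_0)/2 · a³_0 · (a⁴_0 + a⁴_1)/2⟩ = ⟨(a¹_0 a²_0 − a¹_1 a²_1)/2 · a³_1 · (a⁴_0 − a⁴_1)/2⟩ = W for some real W, then W ≤ 1/4. In particular, correlations achieving both values equal to V/√2 cannot be reproduced by such a local model when V > 1/(2√2). -/

import Mathlib

open MeasureTheory

/-- A correlator of a sign-valued response with two functions of the independent sources is
bounded by the product of their first absolute moments. -/
theorem integral_prod_mul_sign_mul_le {α β : Type*} [MeasurableSpace α] [MeasurableSpace β]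
    {μ : Measure α} {ν : Measure β} [SFinite μ] [SFinite ν]
    {u : α → ℝ} {v : β → ℝ} {s : α → β → ℝ} (hu : Integrable u μ) (hv : Integrable v ν)
    (hs : ∀ x y, s x y = 1 ∨ s x y = -1) :
    ∫ p, u p.1 * s p.1 p.2 * v p.2 ∂(μ.prod ν) ≤ (∫ x, |u x| ∂μ) * ∫ y, |v y| ∂ν := by
  rw [← integral_prod_mul (fun x => |u x|) (fun y => |v y|)]
  refine (Real.le_norm_self _).trans
    (norm_integral_le_of_norm_le (hu.abs.mul_prod hv.abs) (.of_forall fun p => ?_))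
  rcases hs p.1 p.2 with h | h <;> simp [h]

/-- Two absolute first moments sum to one if the functions have absolute values summing to one. -/
theorem integral_abs_add_integral_abs_eq_one {α : Type*} [MeasurableSpace α] {μ : Measure α}
    [IsProbabilityMeasure μ] {u v : α → ℝ} (hu : Integrable u μ) (hv : Integrable v μ)
    (h : ∀ x, |u x| + |v x| = 1) : (∫ x, |u x| ∂μ) + ∫ x, |v x| ∂μ = 1 := by
  rw [← integral_add hu.abs hv.abs]
  simp [h]

theorem integrable_of_abs_add_abs_eq_one {α : Type*} [MeasurableSpace α] {μ : Measure α}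
    [IsFiniteMeasure μ] {u v : α → ℝ} (hu : Measurable u)
    (h : ∀ x, |u x| + |v x| = 1) : Integrable u μ :=
  .of_bound hu.aestronglyMeasurable 1 (.of_forall fun x => by
    rw [Real.norm_eq_abs]
    linarith [h x, abs_nonneg (v x)])

theorem le_one_quarter_of_le_mul_of_le_mul {w p p' q q' : ℝ} (hp : 0 ≤ p) (hp' : 0 ≤ p')
    (hq : 0 ≤ q) (hq' : 0 ≤ q') (hpp : p + p' = 1) (hqq : q + q' = 1)
    (h : w ≤ p * q) (h' : w ≤ p' * q') : w ≤ 1 / 4 := by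
  by_contra! hw
  have hP : p * p' ≤ 1 / 4 := by nlinarith [sq_nonneg (p - p')]
  have hQ : q * q' ≤ 1 / 4 := by nlinarith [sq_nonneg (q - q')]
  have hPQ : (p * p') * (q * q') ≤ 1 / 4 * (1 / 4) :=
    mul_le_mul hP hQ (mul_nonneg hq hq') (by norm_num)
  have hww : w * w ≤ (p * q) * (p' * q') :=
    mul_le_mul h h' (by linarith) (mul_nonneg hp hq)
  nlinarith

/-- For every local model on the two-source network in which source `S₁` connects parties
`A¹, A², A³` and source `S₂` connects parties `A³, A⁴`: if
`⟨(a¹_0 a²_1 + a¹_1 a²_0)/2 · a³_0 · (a⁴_0 + a⁴_1)/2⟩ =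
 ⟨(a¹_0 a²_0 − a¹_1 a²_1)/2 · a³_1 · (a⁴_0 − a⁴_1)/2⟩ = W` for some real `W`, then `W ≤ 1/4`.
In particular, if both values equal `V/√2`, then `V ≤ 1/(2√2)` (i.e. such correlations cannot
be reproduced when `V > 1/(2√2)`). -/
theorem mermin_network_local_bound
    {Λ₁ Λ₂ : Type} [MeasurableSpace Λ₁] [MeasurableSpace Λ₂]
    (ρ₁ : Measure Λ₁) (ρ₂ : Measure Λ₂)
    [IsProbabilityMeasure ρ₁] [IsProbabilityMeasure ρ₂]
    (a₁ a₂ : Fin 2 → Λ₁ → ℝ) (a₃ : Fin 2 → Λ₁ → Λ₂ → ℝ) (a₄ : Fin 2 → Λ₂ → ℝ)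
    (ha₁_meas : ∀ x, Measurable (a₁ x)) (ha₂_meas : ∀ x, Measurable (a₂ x))
    (ha₃_meas : ∀ x, Measurable (fun p : Λ₁ × Λ₂ => a₃ x p.1 p.2))
    (ha₄_meas : ∀ x, Measurable (a₄ x))
    (ha₁_val : ∀ x l₁, a₁ x l₁ = 1 ∨ a₁ x l₁ = -1)
    (ha₂_val : ∀ x l₁, a₂ x l₁ = 1 ∨ a₂ x l₁ = -1)
    (ha₃_val : ∀ x l₁ l₂, a₃ x l₁ l₂ = 1 ∨ a₃ x l₁ l₂ = -1)
    (ha₄_val : ∀ x l₂, a₄ x l₂ = 1 ∨ a₄ x l₂ = -1)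
    (W : ℝ)
    (hWp : (∫ p, ((a₁ 0 p.1 * a₂ 1 p.1 + a₁ 1 p.1 * a₂ 0 p.1) / 2) * a₃ 0 p.1 p.2
        * ((a₄ 0 p.2 + a₄ 1 p.2) / 2) ∂(ρ₁.prod ρ₂)) = W)
    (hWm : (∫ p, ((a₁ 0 p.1 * a₂ 0 p.1 - a₁ 1 p.1 * a₂ 1 p.1) / 2) * a₃ 1 p.1 p.2
        * ((a₄ 0 p.2 - a₄ 1 p.2) / 2) ∂(ρ₁.prod ρ₂)) = W) :
    W ≤ 1/4 ∧ ∀ V : ℝ, W = V / Real.sqrt 2 → V ≤ 1 / (2 * Real.sqrt 2) := by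
  have h12 : ∀ x, |(a₁ 0 x * a₂ 1 x + a₁ 1 x * a₂ 0 x) / 2|
      + |(a₁ 0 x * a₂ 0 x - a₁ 1 x * a₂ 1 x) / 2| = 1 := fun x => by
    rcases ha₁_val 0 x with h | h <;> rcases ha₁_val 1 x with h' | h' <;>
      rcases ha₂_val 0 x with k | k <;> rcases ha₂_val 1 x with k' | k' <;>
      rw [h, h', k, k'] <;> norm_num
  have h4 : ∀ y, |(a₄ 0 y + a₄ 1 y) / 2| + |(a₄ 0 y - a₄ 1 y) / 2| = 1 := fun y => by
    rcases ha₄_val 0 y with h | h <;> rcases ha₄_val 1 y with h' | h' <;>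
      rw [h, h'] <;> norm_num
  have hu := integrable_of_abs_add_abs_eq_one (μ := ρ₁)
    ((((ha₁_meas 0).mul (ha₂_meas 1)).add ((ha₁_meas 1).mul (ha₂_meas 0))).div_const 2) h12
  have hu' := integrable_of_abs_add_abs_eq_one (μ := ρ₁)
    ((((ha₁_meas 0).mul (ha₂_meas 0)).sub ((ha₁_meas 1).mul (ha₂_meas 1))).div_const 2)
    fun x => (add_comm _ _).trans (h12 x)
  have hv := integrable_of_abs_add_abs_eq_one (μ := ρ₂)
    (((ha₄_meas 0).add (ha₄_meas 1)).div_const 2) h4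
  have hv' := integrable_of_abs_add_abs_eq_one (μ := ρ₂)
    (((ha₄_meas 0).sub (ha₄_meas 1)).div_const 2) fun y => (add_comm _ _).trans (h4 y)
  have hW : W ≤ 1 / 4 := le_one_quarter_of_le_mul_of_le_mul
    (integral_nonneg fun _ => abs_nonneg _) (integral_nonneg fun _ => abs_nonneg _)
    (integral_nonneg fun _ => abs_nonneg _) (integral_nonneg fun _ => abs_nonneg _)
    (integral_abs_add_integral_abs_eq_one hu hu' h12)
    (integral_abs_add_integral_abs_eq_one hv hv' h4)
    (hWp ▸ integral_prod_mul_sign_mul_le hu hv (ha₃_val 0))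
    (hWm ▸ integral_prod_mul_sign_mul_le hu' hv' (ha₃_val 1))
  refine ⟨hW, fun V hV => ?_⟩
  have hs : 0 < √2 := by positivity
  rw [hV, div_le_iff₀ hs] at hW
  rw [le_div_iff₀ (by positivity)]
  nlinarith [Real.mul_self_sqrt (zero_le_two : (0 : ℝ) ≤ 2)]
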